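/- Let 0 ≤ α < d, 1 < p ≤ q < ∞ with 1/p − 1/q ≤ α/d, let Φ be a Young function, let 𝒟 be a dyadic grid, and let (U,V) be matrix weights satisfying the bump condition [U,V]_{p,q,Φ} := sup_Q |Q|^{α/d + 1/q − 1/p} ( |Q|^{−1}∫_Q ‖U(x)^{1/q} V^{−1/p}‖_{Φ,Q}^q dx )^{1/q} < ∞ (supremum over all cubes). For Q ∈ 𝒟 define N_Q(x) = sup{ |R|^{α/d + 1/q − 1/p} |U(x)^{1/q} 𝒱_R^Φ|_op : R ∈ 𝒟, R ⊆ Q, x ∈ R }, where 𝒱_R^Φ is a reducing operator of V^{−1/p} with respect to Φ on R. Then sup_{Q∈𝒟} |Q|^{−1}∫_Q N_Q(x)^q dx < ∞. -/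

import Mathlib

open MeasureTheory ENNReal
open scoped NNReal ComplexOrder

noncomputable section

abbrev Rd (d : ℕ) := EuclideanSpace ℝ (Fin d)
abbrev Cn (n : ℕ) := EuclideanSpace ℂ (Fin n)
abbrev Mat (n : ℕ) := Matrix (Fin n) (Fin n) ℂ

/-- An axis-parallel (half-open) cube in `ℝ^d`. -/
structure Cube (d : ℕ) where
  corner : Fin d → ℝ
  side : ℝ
  side_pos : 0 < side

namespace Cube

/-- The set of points of a cube. -/
def set {d : ℕ} (Q : Cube d) : Set (Rd d) :=
  {x | ∀ i, Q.corner i ≤ x i ∧ x i < Q.corner i + Q.side}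

/-- The volume `|Q|` of a cube. -/
def vol {d : ℕ} (Q : Cube d) : ℝ := Q.side ^ d

end Cube

/-- A matrix acting on `ℂ^n` (with the Euclidean norm). -/
def mulVecE {n : ℕ} (A : Mat n) (v : Cn n) : Cn n :=
  Matrix.toEuclideanLin A v

/-- The operator norm `|A|_op` of a matrix acting on `ℓ²(ℂ^n)`. -/
def opNorm {n : ℕ} (A : Mat n) : ℝ :=
  ‖Matrix.toEuclideanCLM (𝕜 := ℂ) A‖

/-- Real powers of a self-adjoint matrix, defined via diagonalization. -/
def matPow {n : ℕ} (A : Mat n) (r : ℝ) : Mat n :=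
  if hA : A.IsHermitian then
    (hA.eigenvectorUnitary : Mat n) *
      Matrix.diagonal (fun i => ((hA.eigenvalues i ^ r : ℝ) : ℂ)) *
      (star hA.eigenvectorUnitary : Mat n)
  else A

/-- A matrix weight: self-adjoint matrix valued, locally integrable entries,
positive definite a.e. -/
def IsMatrixWeight {d n : ℕ} (U : Rd d → Mat n) : Prop :=
  (∀ i j, MeasureTheory.LocallyIntegrable (fun x => U x i j) volume) ∧
    (∀ᵐ x, (U x).PosDef)

/-- A Young function: convex, increasing, `Φ(0) = 0` and `Φ(t)/t → ∞`. -/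
structure IsYoungFunction (Φ : ℝ → ℝ) : Prop where
  convexOn : ConvexOn ℝ (Set.Ici 0) Φ
  monotoneOn : MonotoneOn Φ (Set.Ici 0)
  map_zero : Φ 0 = 0
  tendsto : Filter.Tendsto (fun t => Φ t / t) Filter.atTop Filter.atTop

/-- The associate Young function `Φ̄(t) = sup_{s>0} (st - Φ(s))`. -/
def assoc (Φ : ℝ → ℝ) : ℝ → ℝ :=
  fun t => sSup ((fun s => s * t - Φ s) '' Set.Ioi (0 : ℝ))

/-- The `B_{p,q}` condition: `∫_1^∞ Φ(t)^{q/p} t^{-q} dt/t < ∞`. -/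
def MemBpq (Φ : ℝ → ℝ) (p q : ℝ) : Prop :=
  ∫⁻ t in Set.Ioi (1 : ℝ), ENNReal.ofReal (Φ t ^ (q / p) / t ^ (q + 1)) < ⊤

/-- The `B_p` condition: `∫_1^∞ Φ(t) t^{-p} dt/t < ∞`. -/
def MemBp (Φ : ℝ → ℝ) (p : ℝ) : Prop :=
  ∫⁻ t in Set.Ioi (1 : ℝ), ENNReal.ofReal (Φ t / t ^ (p + 1)) < ⊤

/-- Localized Luxemburg (Orlicz) norm over a cube, for `ℝ≥0∞`-valued functions. -/
def luxNormE {d : ℕ} (Φ : ℝ → ℝ) (Q : Cube d) (f : Rd d → ℝ≥0∞) : ℝ≥0∞ :=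
  sInf {lam : ℝ≥0∞ | 0 < lam ∧ lam < ⊤ ∧
    (∫⁻ x in Q.set, ENNReal.ofReal (Φ ((f x).toReal / lam.toReal))) ≤ ENNReal.ofReal Q.vol}

/-- Localized Luxemburg (Orlicz) norm over a cube of a real valued function. -/
def luxNorm {d : ℕ} (Φ : ℝ → ℝ) (Q : Cube d) (f : Rd d → ℝ) : ℝ≥0∞ :=
  luxNormE Φ Q fun x => ENNReal.ofReal |f x|

/-- The (unweighted) `L^p` norm of a vector valued function. -/
def lpNorm {d n : ℕ} (p : ℝ) (f : Rd d → Cn n) : ℝ≥0∞ :=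
  (∫⁻ x, (‖f x‖₊ : ℝ≥0∞) ^ p) ^ (1 / p)

/-- The matrix-weighted `L^p(W)` norm `(∫ |W^{1/p} f|^p)^{1/p}`. -/
def wLpNorm {d n : ℕ} (p : ℝ) (W : Rd d → Mat n) (f : Rd d → Cn n) : ℝ≥0∞ :=
  (∫⁻ x, (‖mulVecE (matPow (W x) (1 / p)) (f x)‖₊ : ℝ≥0∞) ^ p) ^ (1 / p)


/-- A dyadic grid: side lengths are powers of two, cubes are nested or disjoint,
and the cubes of a fixed side length `2^k` partition `ℝ^d`. -/
def IsDyadicGrid {d : ℕ} (𝒟 : Set (Cube d)) : Prop :=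
  (∀ Q ∈ 𝒟, ∃ k : ℤ, Q.side = (2 : ℝ) ^ k) ∧
  (∀ Q ∈ 𝒟, ∀ R ∈ 𝒟, Q.set ⊆ R.set ∨ R.set ⊆ Q.set ∨ Disjoint Q.set R.set) ∧
  (∀ (k : ℤ) (x : Rd d), ∃! Q : Cube d, Q ∈ 𝒟 ∧ Q.side = (2 : ℝ) ^ k ∧ x ∈ Q.set)

/-- `M` is a reducing operator of the matrix function `A` with respect to the Young function `Φ`
on the cube `Q`, with comparability constants `c₁, c₂`:  `|M e| ≈ ‖A e‖_{Φ,Q}` for all `e`. -/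
def ReducesOrlicz {d n : ℕ} (c₁ c₂ : ℝ) (Φ : ℝ → ℝ) (A : Rd d → Mat n) (Q : Cube d)
    (M : Mat n) : Prop :=
  M.PosDef ∧ ∀ e : Cn n,
    ENNReal.ofReal c₁ * luxNorm Φ Q (fun x => ‖mulVecE (A x) e‖) ≤ (‖mulVecE M e‖₊ : ℝ≥0∞) ∧
    (‖mulVecE M e‖₊ : ℝ≥0∞) ≤ ENNReal.ofReal c₂ * luxNorm Φ Q (fun x => ‖mulVecE (A x) e‖)

/-- The bump constant `[U,V]_{p,q,Φ}` of (1.1). -/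
def bumpMax {d n : ℕ} (α p q : ℝ) (Φ : ℝ → ℝ) (U V : Rd d → Mat n) : ℝ≥0∞ :=
  ⨆ Q : Cube d,
    ENNReal.ofReal (Q.vol ^ (α / (d : ℝ) + 1 / q - 1 / p)) *
      ((ENNReal.ofReal Q.vol)⁻¹ *
        ∫⁻ x in Q.set,
          (luxNorm Φ Q fun y =>
            opNorm (matPow (U x) (1 / q) * matPow (V y) (-(1 / p)))) ^ q) ^ (1 / q)

/-- The maximal-type function `N_Q` of (3.1). -/
def NQfun {d n : ℕ} (α p q : ℝ) (𝒟 : Set (Cube d)) (U : Rd d → Mat n) (𝒱 : Cube d → Mat n)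
    (Q : Cube d) (x : Rd d) : ℝ≥0∞ :=
  ⨆ (R : Cube d) (_ : R ∈ 𝒟) (_ : R.set ⊆ Q.set) (_ : x ∈ R.set),
    ENNReal.ofReal (R.vol ^ (α / (d : ℝ) + 1 / q - 1 / p) * opNorm (matPow (U x) (1 / q) * 𝒱 R))

section MatrixFacts

open scoped Matrix.Norms.L2Operator

variable {n : ℕ}

lemma mulVecE_mul (A B : Mat n) (v : Cn n) : mulVecE (A * B) v = mulVecE A (mulVecE B v) := by
  simp [mulVecE, Matrix.toLpLin_apply, Matrix.mulVec_mulVec]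

lemma norm_mulVecE_le (A : Mat n) (v : Cn n) : ‖mulVecE A v‖ ≤ opNorm A * ‖v‖ :=
  (Matrix.toEuclideanCLM (𝕜 := ℂ) A).le_opNorm v

lemma opNorm_nonneg (A : Mat n) : 0 ≤ opNorm A := norm_nonneg _

lemma opNorm_mul_le (A B : Mat n) : opNorm (A * B) ≤ opNorm A * opNorm B :=
  norm_mul_le A B

lemma opNorm_conjTranspose (A : Mat n) : opNorm A.conjTranspose = opNorm A :=
  Matrix.l2_opNorm_conjTranspose A

lemma opNorm_le_sum (A : Mat n) :
    opNorm A ≤ ∑ i, ‖mulVecE A (EuclideanSpace.single i 1)‖ := by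
  refine ContinuousLinearMap.opNorm_le_bound _ (by positivity) fun v => ?_
  have hv : v = ∑ i, v i • EuclideanSpace.single i (1 : ℂ) := by
    ext j
    simp [Finset.sum_apply, Pi.single_apply]
  change ‖mulVecE A v‖ ≤ _
  calc ‖mulVecE A v‖ = ‖∑ i, v i • mulVecE A (EuclideanSpace.single i 1)‖ := by
        conv_lhs => rw [hv]
        simp only [mulVecE, map_sum, map_smul]
    _ ≤ ∑ i, ‖v‖ * ‖mulVecE A (EuclideanSpace.single i 1)‖ := by
        refine (norm_sum_le _ _).trans (Finset.sum_le_sum fun i _ => ?_)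
        rw [norm_smul]
        gcongr
        exact PiLp.norm_apply_le v i
    _ = _ := by rw [← Finset.mul_sum, mul_comm]

lemma opNorm_mul_comm_of_isHermitian {A B : Mat n} (hA : A.IsHermitian) (hB : B.IsHermitian) :
    opNorm (A * B) = opNorm (B * A) := by
  rw [← opNorm_conjTranspose, Matrix.conjTranspose_mul, hA.eq, hB.eq]

lemma matPow_eq_cfc {A : Mat n} (hA : A.IsHermitian) (r : ℝ) :
    matPow A r = cfc (fun t : ℝ => t ^ r) A := by
  rw [hA.cfc_eq, matPow, dif_pos hA, Matrix.IsHermitian.cfc, Unitary.conjStarAlgAut_apply]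
  rfl

lemma matPow_isHermitian {A : Mat n} (hA : A.IsHermitian) (r : ℝ) : (matPow A r).IsHermitian := by
  rw [matPow_eq_cfc hA]
  exact cfc_predicate _ A

lemma continuousOn_matPow {r : ℝ} (hr : 0 ≤ r) :
    ContinuousOn (fun A : Mat n => matPow A r) {A | A.IsHermitian} := by
  have h : ContinuousOn (fun A : Mat n => cfc (fun t : ℝ => t ^ r) A) {A | A.IsHermitian} := by
    refine ContinuousOn.cfc_of_mem_nhdsSet (s := Set.univ) _ Filter.univ_mem continuousOn_id
      (fun A hA => hA) ?_
    exact (Real.continuous_rpow_const hr).continuousOn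
  exact h.congr fun A hA => matPow_eq_cfc hA r

lemma continuous_opNorm : Continuous (opNorm : Mat n → ℝ) :=
  continuous_norm (E := Mat n)

lemma continuous_opNorm_matPow_mul {r : ℝ} (hr : 0 ≤ r) (M : Mat n) :
    Continuous fun A : Mat n =>
      opNorm (matPow ((1 / 2 : ℂ) • (A + A.conjTranspose)) r * M) := by
  refine continuous_opNorm.comp (Continuous.mul ?_ continuous_const)
  refine (continuousOn_matPow hr).comp_continuous (by fun_prop) fun A => ?_
  simp only [Set.mem_ofPred_eq, Matrix.IsHermitian, Matrix.conjTranspose_smul,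
    Matrix.conjTranspose_add, Matrix.conjTranspose_conjTranspose]
  rw [add_comm]
  congr 1
  simp

lemma aemeasurable_opNorm_matPow_mul {d : ℕ} {U : Rd d → Mat n} (hU : IsMatrixWeight U) {r : ℝ}
    (hr : 0 ≤ r) (M : Mat n) : AEMeasurable (fun x => opNorm (matPow (U x) r * M)) := by
  have hUm : AEStronglyMeasurable U := by
    have : AEMeasurable (fun x i j => U x i j) := aemeasurable_pi_lambda _ fun i =>
      aemeasurable_pi_lambda _ fun j => (hU.1 i j).aestronglyMeasurable.aemeasurable
    exact this.aestronglyMeasurable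
  refine ((continuous_opNorm_matPow_mul hr M).comp_aestronglyMeasurable hUm).aemeasurable.congr ?_
  filter_upwards [hU.2] with x hx
  have hs : (1 / 2 : ℂ) • (U x + (U x).conjTranspose) = U x := by
    rw [hx.1.eq, ← two_smul ℂ (U x), smul_smul]
    norm_num
  simp only [hs]

end MatrixFacts

section LuxemburgNorm

variable {d : ℕ} {Φ : ℝ → ℝ}

lemma IsYoungFunction.nonneg (hΦ : IsYoungFunction Φ) {t : ℝ} (ht : 0 ≤ t) : 0 ≤ Φ t :=
  hΦ.map_zero ▸ hΦ.monotoneOn (Set.mem_Ici.2 le_rfl) ht ht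

lemma IsYoungFunction.map_mul_le (hΦ : IsYoungFunction Φ) {θ t : ℝ} (hθ₀ : 0 ≤ θ) (hθ₁ : θ ≤ 1)
    (ht : 0 ≤ t) : Φ (θ * t) ≤ θ * Φ t := by
  have := hΦ.convexOn.2 (Set.mem_Ici.2 ht) (Set.mem_Ici.2 le_rfl) hθ₀ (sub_nonneg.2 hθ₁)
    (by ring)
  simpa [hΦ.map_zero] using this

lemma luxNorm_mono_ae (hΦ : IsYoungFunction Φ) (Q : Cube d) {f g : Rd d → ℝ}
    (h : ∀ᵐ x, |f x| ≤ |g x|) : luxNorm Φ Q f ≤ luxNorm Φ Q g := by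
  refine sInf_le_sInf fun l hl => ⟨hl.1, hl.2.1, le_trans ?_ hl.2.2⟩
  refine lintegral_mono_ae ((ae_restrict_of_ae h).mono fun x hx => ENNReal.ofReal_le_ofReal ?_)
  simp only [ENNReal.toReal_ofReal (abs_nonneg _)]
  refine hΦ.monotoneOn (Set.mem_Ici.2 (by positivity)) (Set.mem_Ici.2 (by positivity)) ?_
  gcongr

lemma vol_lt_lintegral_of_lt_luxNorm {R : Cube d} {f : Rd d → ℝ} {L : ℝ} (hL : 0 < L)
    (h : ENNReal.ofReal L < luxNorm Φ R f) :
    ENNReal.ofReal R.vol < ∫⁻ x in R.set, ENNReal.ofReal (Φ (|f x| / L)) := by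
  by_contra! hle
  refine h.not_ge (sInf_le ⟨ENNReal.ofReal_pos.2 hL, ENNReal.ofReal_lt_top, ?_⟩)
  simpa only [ENNReal.toReal_ofReal (abs_nonneg _), ENNReal.toReal_ofReal hL.le] using hle

lemma lintegral_le_of_luxNorm_lt (hΦ : IsYoungFunction Φ) {Q : Cube d} {f : Rd d → ℝ} {M K : ℝ}
    (hK : 1 ≤ K) (h : luxNorm Φ Q f < ENNReal.ofReal M) :
    ∫⁻ x in Q.set, ENNReal.ofReal (Φ (|f x| / (K * M))) ≤
      ENNReal.ofReal K⁻¹ * ENNReal.ofReal Q.vol := by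
  obtain ⟨l, ⟨hl0, hlt, hl⟩, hlM⟩ := sInf_lt_iff.1 h
  have hl0' : 0 < l.toReal := ENNReal.toReal_pos hl0.ne' hlt.ne
  have hlM' : l.toReal < M := (ENNReal.lt_ofReal_iff_toReal_lt hlt.ne).1 hlM
  have hM : 0 < M := hl0'.trans hlM'
  have hK0 : 0 < K := by linarith
  simp only [ENNReal.toReal_ofReal (abs_nonneg _)] at hl
  calc ∫⁻ x in Q.set, ENNReal.ofReal (Φ (|f x| / (K * M)))
      ≤ ∫⁻ x in Q.set, ENNReal.ofReal K⁻¹ * ENNReal.ofReal (Φ (|f x| / l.toReal)) := by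
        refine lintegral_mono fun x => ?_
        rw [← ENNReal.ofReal_mul (by positivity)]
        refine ENNReal.ofReal_le_ofReal ?_
        refine le_trans ?_ (hΦ.map_mul_le (by positivity) (inv_le_one_of_one_le₀ hK)
          (by positivity))
        refine hΦ.monotoneOn (Set.mem_Ici.2 (by positivity)) (Set.mem_Ici.2 (by positivity)) ?_
        rw [inv_mul_eq_div, div_div, mul_comm]
        gcongr
    _ ≤ _ := by
        rw [lintegral_const_mul' _ _ ENNReal.ofReal_ne_top]
        gcongr

end LuxemburgNorm

section DyadicGrid

variable {d : ℕ}

lemma Cube.vol_pos (Q : Cube d) : 0 < Q.vol := pow_pos Q.side_pos d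

lemma Cube.measurableSet_set (Q : Cube d) : MeasurableSet Q.set := by
  have : Q.set = ⋂ i, {x : Rd d | Q.corner i ≤ x i ∧ x i < Q.corner i + Q.side} := by
    ext; simp [Cube.set]
  rw [this]
  refine MeasurableSet.iInter fun i => ?_
  have hm : Measurable fun x : Rd d => x i := by fun_prop
  exact hm measurableSet_Ico

lemma Cube.interior_set_nonempty (Q : Cube d) : (interior Q.set).Nonempty := by
  let y : Rd d := WithLp.toLp 2 fun i => Q.corner i + Q.side / 2
  have hs := Q.side_pos
  refine ⟨y, mem_interior.2
    ⟨⋂ i, {x : Rd d | Q.corner i < x i ∧ x i < Q.corner i + Q.side}, ?_, ?_, ?_⟩⟩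
  · intro x hx i
    have := Set.mem_iInter.1 hx i
    exact ⟨this.1.le, this.2⟩
  · refine isOpen_iInter_of_finite fun i => ?_
    have hm : Continuous fun x : Rd d => x i := by fun_prop
    exact isOpen_Ioo.preimage hm
  · refine Set.mem_iInter.2 fun i => ?_
    constructor <;> simp only [y] <;> linarith

lemma Cube.set_nonempty (Q : Cube d) : Q.set.Nonempty :=
  Q.interior_set_nonempty.mono interior_subset

lemma Cube.side_le_of_subset (hd : 0 < d) {R Q : Cube d} (h : R.set ⊆ Q.set) :
    R.side ≤ Q.side := by
  by_contra! hlt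
  have hR := R.side_pos
  have hQ := Q.side_pos
  have h₁ : (WithLp.toLp 2 R.corner : Rd d) ∈ R.set := fun i => ⟨le_rfl, by simpa using hR⟩
  have h₂ : (WithLp.toLp 2 (fun i => R.corner i + Q.side) : Rd d) ∈ R.set := fun i =>
    ⟨by simpa using hQ.le, by simpa using hlt⟩
  have h₃ := (h h₁ ⟨0, hd⟩).1
  have h₄ := (h h₂ ⟨0, hd⟩).2
  simp only at h₃ h₄
  linarith

lemma Cube.vol_le_of_subset (hd : 0 < d) {R Q : Cube d} (h : R.set ⊆ Q.set) : R.vol ≤ Q.vol :=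
  pow_le_pow_left₀ R.side_pos.le (side_le_of_subset hd h) d

namespace IsDyadicGrid

variable {𝒟 : Set (Cube d)}

lemma eq_of_side_eq (h𝒟 : IsDyadicGrid 𝒟) {R S : Cube d} (hR : R ∈ 𝒟) (hS : S ∈ 𝒟)
    (h : R.side = S.side) {x : Rd d} (hxR : x ∈ R.set) (hxS : x ∈ S.set) : R = S := by
  obtain ⟨k, hk⟩ := h𝒟.1 R hR
  exact (h𝒟.2.2 k x).unique ⟨hR, hk, hxR⟩ ⟨hS, h ▸ hk, hxS⟩

lemma countable (h𝒟 : IsDyadicGrid 𝒟) : 𝒟.Countable := by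
  have : 𝒟 = ⋃ k : ℤ, {R ∈ 𝒟 | R.side = (2 : ℝ) ^ k} := by
    ext R
    simp only [Set.mem_iUnion, Set.mem_ofPred_eq]
    exact ⟨fun hR => (h𝒟.1 R hR).imp fun k hk => ⟨hR, hk⟩, fun ⟨_, hR, _⟩ => hR⟩
  rw [this]
  refine Set.countable_iUnion fun k => ?_
  refine Set.PairwiseDisjoint.countable_of_nonempty_interior (s := Cube.set) ?_
    fun R _ => R.interior_set_nonempty
  intro R hR S hS hne
  refine Set.disjoint_left.2 fun x hxR hxS => hne ?_
  exact h𝒟.eq_of_side_eq hR.1 hS.1 (hR.2.trans hS.2.symm) hxR hxS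

lemma side_le_half (h𝒟 : IsDyadicGrid 𝒟) (hd : 0 < d) {R Q : Cube d} (hR : R ∈ 𝒟)
    (hQ : Q ∈ 𝒟) (h : R.set ⊆ Q.set) (hne : R ≠ Q) : R.side ≤ Q.side / 2 := by
  obtain ⟨k, hk⟩ := h𝒟.1 R hR
  obtain ⟨l, hl⟩ := h𝒟.1 Q hQ
  obtain ⟨x, hx⟩ := R.set_nonempty
  have hlt : R.side < Q.side := (Cube.side_le_of_subset hd h).lt_of_ne fun he =>
    hne (h𝒟.eq_of_side_eq hR hQ he hx (h hx))
  rw [hk, hl] at hlt ⊢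
  have hkl : k < l := (zpow_lt_zpow_iff_right₀ _root_.one_lt_two).1 hlt
  rw [div_eq_mul_inv, ← zpow_sub_one₀ two_ne_zero]
  exact zpow_le_zpow_right₀ one_le_two (by omega)

/-- Every point of a cube of a subfamily of the grid with bounded side lengths lies in a maximal
cube of the subfamily. -/
lemma exists_maximal (h𝒟 : IsDyadicGrid 𝒟) (hd : 0 < d) {Q R : Cube d} {S : Set (Cube d)}
    (hS : S ⊆ 𝒟) (hQ : Q ∈ 𝒟) (hSQ : ∀ R ∈ S, R.set ⊆ Q.set) (hR : R ∈ S) {x : Rd d} (hx : x ∈ R.set) :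
    ∃ R₀ ∈ S, x ∈ R₀.set ∧ ∀ T ∈ S, R₀.set ⊆ T.set → T = R₀ := by
  obtain ⟨l, hl⟩ := h𝒟.1 Q hQ
  obtain ⟨k, hk⟩ := h𝒟.1 R (hS hR)
  obtain ⟨k₀, ⟨R₀, hR₀, hxR₀, hk₀⟩, hmax⟩ := Int.exists_greatest_of_bdd
    (P := fun k : ℤ => ∃ R ∈ S, x ∈ R.set ∧ R.side = (2 : ℝ) ^ k)
    ⟨l, fun k ⟨R, hR, _, hk⟩ => (zpow_le_zpow_iff_right₀ (_root_.one_lt_two (α := ℝ))).1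
      (hk ▸ hl ▸ Cube.side_le_of_subset hd (hSQ R hR))⟩ ⟨k, R, hR, hx, hk⟩
  refine ⟨R₀, hR₀, hxR₀, fun T hT hsub => ?_⟩
  obtain ⟨m, hm⟩ := h𝒟.1 T (hS hT)
  refine h𝒟.eq_of_side_eq (hS hT) (hS hR₀) (le_antisymm ?_ (Cube.side_le_of_subset hd hsub))
    (hsub hxR₀) hxR₀
  rw [hm, hk₀]
  exact zpow_le_zpow_right₀ one_le_two (hmax m ⟨T, hT, hsub hxR₀, hm⟩)

lemma pairwiseDisjoint_of_maximal (h𝒟 : IsDyadicGrid 𝒟) {S : Set (Cube d)} (hS : S ⊆ 𝒟)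
    (hmax : ∀ R ∈ S, ∀ T ∈ S, R.set ⊆ T.set → T = R) : S.PairwiseDisjoint Cube.set := by
  intro R hR T hT hne
  rcases h𝒟.2.1 R (hS hR) T (hS hT) with h | h | h
  · exact absurd (hmax R hR T hT h).symm hne
  · exact absurd (hmax T hT R hR h) hne
  · exact h

end IsDyadicGrid

end DyadicGrid

section StoppingTime

variable {d : ℕ}

/-- The supremum of `F R x` over the cubes `R ∋ x` of the grid that are contained in `Q` and whose
side length is at least `2 ^ (-m)`. -/
def truncSup (𝒟 : Set (Cube d)) (F : Cube d → Rd d → ℝ≥0∞) (m : ℕ) (Q : Cube d) (x : Rd d) :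
    ℝ≥0∞ :=
  ⨆ R ∈ {R ∈ 𝒟 | R.set ⊆ Q.set ∧ (1 / 2 : ℝ) ^ m ≤ R.side}, R.set.indicator (F R) x

variable {𝒟 : Set (Cube d)} {F : Cube d → Rd d → ℝ≥0∞}

lemma le_truncSup {m : ℕ} {Q R : Cube d} (hR : R ∈ 𝒟) (hRQ : R.set ⊆ Q.set)
    (hm : (1 / 2 : ℝ) ^ m ≤ R.side) {x : Rd d} (hx : x ∈ R.set) :
    F R x ≤ truncSup 𝒟 F m Q x :=
  le_iSup₂_of_le R ⟨hR, hRQ, hm⟩ (Set.indicator_of_mem hx _).ge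

lemma truncSup_le {m : ℕ} {Q : Cube d} {x : Rd d} {b : ℝ≥0∞}
    (h : ∀ R ∈ 𝒟, R.set ⊆ Q.set → (1 / 2 : ℝ) ^ m ≤ R.side → x ∈ R.set → F R x ≤ b) :
    truncSup 𝒟 F m Q x ≤ b := by
  refine iSup₂_le fun R hR => ?_
  by_cases hx : x ∈ R.set
  · rw [Set.indicator_of_mem hx]
    exact h R hR.1 hR.2.1 hR.2.2 hx
  · simp [Set.indicator_of_notMem hx]

lemma monotone_truncSup (Q : Cube d) (x : Rd d) :
    Monotone fun m => truncSup 𝒟 F m Q x := fun _ _ hmn =>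
  truncSup_le fun _ hR hRQ hm hx => le_truncSup hR hRQ
    ((pow_le_pow_of_le_one (by norm_num) (by norm_num) hmn).trans hm) hx

lemma iSup_truncSup (Q : Cube d) (x : Rd d) :
    ⨆ m, truncSup 𝒟 F m Q x =
      ⨆ (R : Cube d) (_ : R ∈ 𝒟) (_ : R.set ⊆ Q.set) (_ : x ∈ R.set), F R x := by
  refine le_antisymm (iSup_le fun m => truncSup_le fun R hR hRQ _ hx => ?_) ?_
  · exact le_iSup₂_of_le R hR (le_iSup₂_of_le hRQ hx le_rfl)
  · refine iSup₂_le fun R hR => iSup₂_le fun hRQ hx => ?_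
    obtain ⟨m, hm⟩ := exists_pow_lt_of_lt_one R.side_pos (by norm_num : (1 / 2 : ℝ) < 1)
    exact le_iSup_of_le m (le_truncSup hR hRQ hm.le hx)

lemma aemeasurable_truncSup (h𝒟 : IsDyadicGrid 𝒟) (hF : ∀ R ∈ 𝒟, AEMeasurable (F R)) (m : ℕ)
    (Q : Cube d) : AEMeasurable (truncSup 𝒟 F m Q) := by
  refine AEMeasurable.biSup _ (h𝒟.countable.mono fun R hR => hR.1) fun R hR => ?_
  exact (hF R hR.1).indicator R.measurableSet_set

/-- The pointwise estimate behind the stopping time argument. -/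
lemma truncSup_le_of_stopping (h𝒟 : IsDyadicGrid 𝒟) (hd : 0 < d) {bad : Cube d → Prop}
    {Q : Cube d} (hQ : Q ∈ 𝒟) {A : Rd d → ℝ≥0∞}
    (hA : ∀ R ∈ 𝒟, R.set ⊆ Q.set → ¬ bad R → ∀ x, F R x ≤ A x) {S : Set (Cube d)}
    (hS : S = {R ∈ 𝒟 | R.set ⊆ Q.set ∧ bad R ∧
      ∀ T ∈ 𝒟, T.set ⊆ Q.set → bad T → R.set ⊆ T.set → T = R}) (m : ℕ) (x : Rd d) :
    truncSup 𝒟 F m Q x ≤ A x ∨ ∃ R ∈ S, x ∈ R.set ∧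
      truncSup 𝒟 F m Q x ≤ max (A x) (truncSup 𝒟 F m R x) := by
  by_cases hbad : ∃ R ∈ 𝒟, R.set ⊆ Q.set ∧ bad R ∧ x ∈ R.set
  · right
    obtain ⟨R, hR, hRQ, hRb, hx⟩ := hbad
    obtain ⟨R₀, hR₀, hxR₀, hmax⟩ := h𝒟.exists_maximal hd
      (S := {R ∈ 𝒟 | R.set ⊆ Q.set ∧ bad R}) (fun R hR => hR.1) hQ (fun R hR => hR.2.1)
      ⟨hR, hRQ, hRb⟩ hx
    refine ⟨R₀, hS ▸ ⟨hR₀.1, hR₀.2.1, hR₀.2.2, fun T h₁ h₂ h₃ => hmax T ⟨h₁, h₂, h₃⟩⟩, hxR₀,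
      truncSup_le fun T hT hTQ hm hxT => ?_⟩
    by_cases hTb : bad T
    · refine le_max_of_le_right (le_truncSup hT ?_ hm hxT)
      rcases h𝒟.2.1 T hT R₀ hR₀.1 with h | h | h
      · exact h
      · rw [hmax T ⟨hT, hTQ, hTb⟩ h]
      · exact absurd hxR₀ (Set.disjoint_left.1 h hxT)
    · exact le_max_of_le_left (hA T hT hTQ hTb x)
  · left
    push Not at hbad
    exact truncSup_le fun T hT hTQ _ hxT => hA T hT hTQ (fun h => hbad T hT hTQ h hxT) x

/-- An abstract stopping time argument: if the averages of `(C * F Q) ^ q` over `Q` are bounded and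
the bad subcubes of each cube are sparse, then the averages of the localized maximal function are
bounded. -/
lemma lintegral_truncSup_le (h𝒟 : IsDyadicGrid 𝒟) (hd : 0 < d)
    (hF : ∀ R ∈ 𝒟, AEMeasurable (F R)) {bad : Cube d → Cube d → Prop} {C C₁ : ℝ≥0∞} {q : ℝ}
    (hq : 0 < q)
    (hgood : ∀ Q ∈ 𝒟, ∀ R ∈ 𝒟, R.set ⊆ Q.set → ¬ bad Q R → ∀ x, F R x ≤ C * F Q x)
    (hself : ∀ Q ∈ 𝒟, ¬ bad Q Q)
    (hsparse : ∀ Q ∈ 𝒟, ∀ S ⊆ {R ∈ 𝒟 | R.set ⊆ Q.set ∧ bad Q R}, S.PairwiseDisjoint Cube.set →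
      ∑' R : S, ENNReal.ofReal R.1.vol ≤ 2⁻¹ * ENNReal.ofReal Q.vol)
    (hint : ∀ Q ∈ 𝒟, ∫⁻ x in Q.set, (C * F Q x) ^ q ≤ C₁ * ENNReal.ofReal Q.vol)
    (m : ℕ) {Q : Cube d} (hQ : Q ∈ 𝒟) :
    ∫⁻ x in Q.set, truncSup 𝒟 F m Q x ^ q ≤ 2 * C₁ * ENNReal.ofReal Q.vol := by
  obtain ⟨j, hj⟩ : ∃ j : ℕ, Q.side < 2 ^ j * (1 / 2 : ℝ) ^ m := by
    obtain ⟨j, hj⟩ := pow_unbounded_of_one_lt (Q.side / (1 / 2 : ℝ) ^ m) (_root_.one_lt_two)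
    exact ⟨j, (div_lt_iff₀ (by positivity)).1 hj⟩
  induction j generalizing Q with
  | zero =>
    have h0 : ∀ x, truncSup 𝒟 F m Q x = 0 := fun x => by
      refine le_antisymm (truncSup_le fun R hR hRQ hm _ => ?_) bot_le
      have := Cube.side_le_of_subset hd hRQ
      rw [pow_zero, one_mul] at hj
      linarith
    simp [h0, hq]
  | succ j ih =>
    set S : Set (Cube d) := {R ∈ 𝒟 | R.set ⊆ Q.set ∧ bad Q R ∧
      ∀ T ∈ 𝒟, T.set ⊆ Q.set → bad Q T → R.set ⊆ T.set → T = R} with hS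
    have hS𝒟 : S ⊆ 𝒟 := fun R hR => hR.1
    have hScount : S.Countable := h𝒟.countable.mono hS𝒟
    have hSdisj : S.PairwiseDisjoint Cube.set := h𝒟.pairwiseDisjoint_of_maximal hS𝒟
      fun R hR T hT hRT => hR.2.2.2 T hT.1 hT.2.1 hT.2.2.1 hRT
    have hScount' : Countable S := hScount.to_subtype
    have hpt : ∀ x, truncSup 𝒟 F m Q x ^ q ≤
        (C * F Q x) ^ q + ∑' R : S, R.1.set.indicator (fun x => truncSup 𝒟 F m R x ^ q) x := by
      intro x
      rcases truncSup_le_of_stopping h𝒟 hd hQ (hgood Q hQ) hS m x with h | ⟨R, hR, hx, h⟩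
      · exact le_add_right (ENNReal.rpow_le_rpow h hq.le)
      · have h₁ : truncSup 𝒟 F m R x ^ q ≤
            ∑' R : S, R.1.set.indicator (fun x => truncSup 𝒟 F m R x ^ q) x := by
          refine le_trans ?_ (ENNReal.le_tsum ⟨R, hR⟩)
          rw [Set.indicator_of_mem hx]
        rcases le_max_iff.1 h with h | h
        · exact le_add_right (ENNReal.rpow_le_rpow h hq.le)
        · exact le_add_left ((ENNReal.rpow_le_rpow h hq.le).trans h₁)
    have hAm : AEMeasurable (fun x => (C * F Q x) ^ q) :=
      ((hF Q hQ).const_mul C).pow_const q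
    calc ∫⁻ x in Q.set, truncSup 𝒟 F m Q x ^ q
        ≤ ∫⁻ x in Q.set, ((C * F Q x) ^ q +
            ∑' R : S, R.1.set.indicator (fun x => truncSup 𝒟 F m R x ^ q) x) :=
          lintegral_mono hpt
      _ = (∫⁻ x in Q.set, (C * F Q x) ^ q) + ∑' R : S, ∫⁻ x in Q.set,
            R.1.set.indicator (fun x => truncSup 𝒟 F m R x ^ q) x := by
          rw [lintegral_add_left' hAm.restrict, lintegral_tsum fun R => ?_]
          exact (((aemeasurable_truncSup h𝒟 hF m R.1).pow_const q).indicator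
            R.1.measurableSet_set).restrict
      _ ≤ C₁ * ENNReal.ofReal Q.vol + ∑' R : S, 2 * C₁ * ENNReal.ofReal R.1.vol := by
          refine add_le_add (hint Q hQ) (ENNReal.tsum_le_tsum fun R => ?_)
          refine (setLIntegral_le_lintegral _ _).trans ?_
          rw [lintegral_indicator R.1.measurableSet_set]
          refine ih R.2.1 ?_
          have hne : R.1 ≠ Q := fun h => hself Q hQ (h ▸ R.2.2.2.1)
          have := h𝒟.side_le_half hd R.2.1 hQ R.2.2.1 hne
          rw [pow_succ] at hj
          linarith
      _ ≤ C₁ * ENNReal.ofReal Q.vol + 2 * C₁ * (2⁻¹ * ENNReal.ofReal Q.vol) := by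
          rw [ENNReal.tsum_mul_left]
          gcongr
          exact hsparse Q hQ S (fun R hR => ⟨hR.1, hR.2.1, hR.2.2.1⟩) hSdisj
      _ = 2 * C₁ * ENNReal.ofReal Q.vol := by
          rw [mul_comm 2 C₁, mul_assoc C₁ 2, ← mul_assoc 2 2⁻¹,
            ENNReal.mul_inv_cancel two_ne_zero ENNReal.ofNat_ne_top, one_mul, mul_assoc, two_mul,
            mul_add]

lemma lintegral_iSup_le_of_stopping (h𝒟 : IsDyadicGrid 𝒟) (hd : 0 < d)
    (hF : ∀ R ∈ 𝒟, AEMeasurable (F R)) {bad : Cube d → Cube d → Prop} {C C₁ : ℝ≥0∞} {q : ℝ}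
    (hq : 0 < q)
    (hgood : ∀ Q ∈ 𝒟, ∀ R ∈ 𝒟, R.set ⊆ Q.set → ¬ bad Q R → ∀ x, F R x ≤ C * F Q x)
    (hself : ∀ Q ∈ 𝒟, ¬ bad Q Q)
    (hsparse : ∀ Q ∈ 𝒟, ∀ S ⊆ {R ∈ 𝒟 | R.set ⊆ Q.set ∧ bad Q R}, S.PairwiseDisjoint Cube.set →
      ∑' R : S, ENNReal.ofReal R.1.vol ≤ 2⁻¹ * ENNReal.ofReal Q.vol)
    (hint : ∀ Q ∈ 𝒟, ∫⁻ x in Q.set, (C * F Q x) ^ q ≤ C₁ * ENNReal.ofReal Q.vol)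
    {Q : Cube d} (hQ : Q ∈ 𝒟) :
    ∫⁻ x in Q.set,
        (⨆ (R : Cube d) (_ : R ∈ 𝒟) (_ : R.set ⊆ Q.set) (_ : x ∈ R.set), F R x) ^ q ≤
      2 * C₁ * ENNReal.ofReal Q.vol := by
  have hsup : ∀ x, (⨆ (R : Cube d) (_ : R ∈ 𝒟) (_ : R.set ⊆ Q.set) (_ : x ∈ R.set), F R x) ^ q =
      ⨆ m, truncSup 𝒟 F m Q x ^ q := fun x => by
    rw [← iSup_truncSup]
    exact (ENNReal.orderIsoRpow q hq).map_iSup _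
  simp only [hsup]
  rw [lintegral_iSup' (fun m => ((aemeasurable_truncSup h𝒟 hF m Q).pow_const q).restrict)
    (ae_of_all _ fun x m k hmk => ENNReal.rpow_le_rpow (monotone_truncSup Q x hmk) hq.le)]
  exact iSup_le fun m =>
    lintegral_truncSup_le h𝒟 hd hF hq hgood hself hsparse hint m hQ

end StoppingTime

section ReducingOperators

variable {d n : ℕ} {c₁ c₂ : ℝ} {Φ : ℝ → ℝ} {W : Rd d → Mat n}

/-- The norms of the columns of `W y * M⁻¹`. -/
def colNorm (W : Rd d → Mat n) (M : Mat n) (i : Fin n) (y : Rd d) : ℝ :=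
  ‖mulVecE (W y) (mulVecE M⁻¹ (EuclideanSpace.single i 1))‖

lemma abs_colNorm (M : Mat n) (i : Fin n) (y : Rd d) : |colNorm W M i y| = colNorm W M i y :=
  abs_of_nonneg (norm_nonneg _)

lemma ReducesOrlicz.norm_mulVecE_le {R : Cube d} {M : Mat n} (h : ReducesOrlicz c₁ c₂ Φ W R M)
    (hc₂ : 0 < c₂) {L : ℝ} (hL : 0 ≤ L) {e : Cn n}
    (he : luxNorm Φ R (fun x => ‖mulVecE (W x) e‖) ≤ ENNReal.ofReal L) :
    ‖mulVecE M e‖ ≤ c₂ * L := by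
  have h₁ := (h.2 e).2.trans (mul_le_mul_right he _)
  rw [← ENNReal.ofReal_mul hc₂.le, ← enorm_eq_nnnorm, ← ofReal_norm] at h₁
  exact (ENNReal.ofReal_le_ofReal_iff (by positivity)).1 h₁

lemma ReducesOrlicz.opNorm_mul_inv_le {R : Cube d} {M : Mat n}
    (h : ReducesOrlicz c₁ c₂ Φ W R M) (hc₂ : 0 < c₂) {L : ℝ} (hL : 0 ≤ L) {N : Mat n}
    (hN : ∀ i, luxNorm Φ R (colNorm W N i) ≤ ENNReal.ofReal L) :
    opNorm (M * N⁻¹) ≤ n * (c₂ * L) := by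
  refine (opNorm_le_sum _).trans ?_
  refine (Finset.sum_le_card_nsmul _ _ (c₂ * L) fun i _ => ?_).trans (by simp)
  rw [mulVecE_mul]
  exact h.norm_mulVecE_le hc₂ hL (hN i)

lemma ReducesOrlicz.luxNorm_colNorm_lt {Q : Cube d} {M : Mat n}
    (h : ReducesOrlicz c₁ c₂ Φ W Q M) (hc₁ : 0 < c₁) (i : Fin n) :
    luxNorm Φ Q (colNorm W M i) < ENNReal.ofReal (2 / c₁) := by
  by_contra! hle
  have h₁ := (mul_le_mul_right hle (ENNReal.ofReal c₁)).trans
    (h.2 (mulVecE M⁻¹ (EuclideanSpace.single i 1))).1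
  rw [← mulVecE_mul, Matrix.mul_nonsing_inv _ ((Matrix.isUnit_iff_isUnit_det _).1 h.1.isUnit),
    ← ENNReal.ofReal_mul hc₁.le, ← enorm_eq_nnnorm, ← ofReal_norm] at h₁
  have h₂ := (ENNReal.ofReal_le_ofReal_iff (norm_nonneg _)).1 h₁
  rw [mul_div_cancel₀ _ hc₁.ne'] at h₂
  simp [mulVecE] at h₂

/-- If `A` and a.e. `W y` are Hermitian, then `|A M|_op` is controlled by the Luxemburg norm of
`|A W(y)|_op`. -/
lemma ReducesOrlicz.ofReal_opNorm_mul_le {Q : Cube d} {M : Mat n}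
    (h : ReducesOrlicz c₁ c₂ Φ W Q M) (hΦ : IsYoungFunction Φ)
    {A : Mat n} (hA : A.IsHermitian) (hW : ∀ᵐ y, (W y).IsHermitian) :
    ENNReal.ofReal (opNorm (A * M)) ≤
      ENNReal.ofReal (n * c₂) * luxNorm Φ Q (fun y => opNorm (A * W y)) := by
  rw [opNorm_mul_comm_of_isHermitian hA h.1.1]
  calc ENNReal.ofReal (opNorm (M * A))
      ≤ ∑ i, ENNReal.ofReal ‖mulVecE M (mulVecE A (EuclideanSpace.single i 1))‖ := by
        rw [← ENNReal.ofReal_sum_of_nonneg fun _ _ => norm_nonneg _]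
        refine ENNReal.ofReal_le_ofReal ((opNorm_le_sum _).trans_eq ?_)
        simp only [mulVecE_mul]
    _ ≤ ∑ _i : Fin n, ENNReal.ofReal c₂ * luxNorm Φ Q (fun y => opNorm (A * W y)) := by
        refine Finset.sum_le_sum fun i _ => ?_
        rw [ofReal_norm, enorm_eq_nnnorm]
        refine (h.2 _).2.trans (mul_le_mul_right (luxNorm_mono_ae hΦ Q ?_) _)
        filter_upwards [hW] with y hy
        rw [abs_of_nonneg (norm_nonneg _), abs_of_nonneg (opNorm_nonneg _), ← mulVecE_mul,
          opNorm_mul_comm_of_isHermitian hA hy]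
        simpa using _root_.norm_mulVecE_le (W y * A) (EuclideanSpace.single i 1)
    _ = _ := by
        rw [Finset.sum_const, Finset.card_univ, Fintype.card_fin, nsmul_eq_mul,
          ENNReal.ofReal_mul (by positivity), ENNReal.ofReal_natCast, mul_assoc]

lemma ReducesOrlicz.tsum_vol_le {Q : Cube d} {M : Mat n} (h : ReducesOrlicz c₁ c₂ Φ W Q M)
    (hc₁ : 0 < c₁) (hΦ : IsYoungFunction Φ) {S : Set (Cube d)} (hS : S.Countable)
    (hSQ : ∀ R ∈ S, R.set ⊆ Q.set) (hSdisj : S.PairwiseDisjoint Cube.set)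
    (hbad : ∀ R ∈ S, ∃ i,
      ENNReal.ofReal (2 * (n + 1) * (2 / c₁)) < luxNorm Φ R (colNorm W M i)) :
    ∑' R : S, ENNReal.ofReal R.1.vol ≤ 2⁻¹ * ENNReal.ofReal Q.vol := by
  set L : ℝ := 2 * (n + 1) * (2 / c₁)
  have hL0 : 0 < L := by positivity
  set f : Fin n → Rd d → ℝ≥0∞ := fun i y => ENNReal.ofReal (Φ (|colNorm W M i y| / L))
  calc ∑' R : S, ENNReal.ofReal R.1.vol
      ≤ ∑' R : S, ∑ i, ∫⁻ y in R.1.set, f i y := by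
        refine ENNReal.tsum_le_tsum fun R => ?_
        obtain ⟨i, hi⟩ := hbad R.1 R.2
        exact (vol_lt_lintegral_of_lt_luxNorm hL0 hi).le.trans
          (Finset.single_le_sum (f := fun i => ∫⁻ y in R.1.set, f i y) (fun _ _ => bot_le)
            (Finset.mem_univ i))
    _ = ∑ i, ∫⁻ y in ⋃ R ∈ S, R.set, f i y := by
        rw [Summable.tsum_finsetSum fun _ _ => ENNReal.summable]
        refine Finset.sum_congr rfl fun i _ => ?_
        rw [lintegral_biUnion hS (fun R _ => R.measurableSet_set) hSdisj]
    _ ≤ ∑ _i : Fin n, ENNReal.ofReal (2 * (n + 1) : ℝ)⁻¹ * ENNReal.ofReal Q.vol := by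
        refine Finset.sum_le_sum fun i _ => ?_
        refine (lintegral_mono_set (Set.iUnion₂_subset hSQ)).trans ?_
        refine lintegral_le_of_luxNorm_lt hΦ ?_ (h.luxNorm_colNorm_lt hc₁ i)
        have : (0 : ℝ) ≤ n := by positivity
        linarith
    _ ≤ 2⁻¹ * ENNReal.ofReal Q.vol := by
        rw [Finset.sum_const, Finset.card_univ, Fintype.card_fin, nsmul_eq_mul, ← mul_assoc]
        gcongr
        have h2 : (2⁻¹ : ℝ≥0∞) = ENNReal.ofReal 2⁻¹ := by
          rw [ENNReal.ofReal_inv_of_pos two_pos, ENNReal.ofReal_ofNat]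
        rw [← ENNReal.ofReal_natCast, ← ENNReal.ofReal_mul (by positivity), h2]
        refine ENNReal.ofReal_le_ofReal ?_
        have hn : (0 : ℝ) ≤ n := by positivity
        rw [← div_eq_mul_inv, div_le_iff₀ (by positivity)]
        linarith

end ReducingOperators

lemma lintegral_luxNorm_rpow_le_bumpMax {d n : ℕ} {α p q : ℝ} (hq : 0 < q) {Φ : ℝ → ℝ}
    {U V : Rd d → Mat n} (Q : Cube d) :
    ENNReal.ofReal (Q.vol ^ (α / (d : ℝ) + 1 / q - 1 / p)) ^ q *
      ∫⁻ x in Q.set, (luxNorm Φ Q fun y =>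
        opNorm (matPow (U x) (1 / q) * matPow (V y) (-(1 / p)))) ^ q ≤
      bumpMax α p q Φ U V ^ q * ENNReal.ofReal Q.vol := by
  set I := ∫⁻ x in Q.set, (luxNorm Φ Q fun y =>
    opNorm (matPow (U x) (1 / q) * matPow (V y) (-(1 / p)))) ^ q
  set a := ENNReal.ofReal (Q.vol ^ (α / (d : ℝ) + 1 / q - 1 / p))
  have hv : ENNReal.ofReal Q.vol ≠ 0 := (ENNReal.ofReal_pos.2 Q.vol_pos).ne'
  have h : a * ((ENNReal.ofReal Q.vol)⁻¹ * I) ^ (1 / q) ≤ bumpMax α p q Φ U V :=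
    le_iSup (fun Q : Cube d => ENNReal.ofReal (Q.vol ^ (α / (d : ℝ) + 1 / q - 1 / p)) *
      ((ENNReal.ofReal Q.vol)⁻¹ * ∫⁻ x in Q.set, (luxNorm Φ Q fun y =>
        opNorm (matPow (U x) (1 / q) * matPow (V y) (-(1 / p)))) ^ q) ^ (1 / q)) Q
  calc a ^ q * I
      = (a * ((ENNReal.ofReal Q.vol)⁻¹ * I) ^ (1 / q)) ^ q * ENNReal.ofReal Q.vol := by
        rw [ENNReal.mul_rpow_of_nonneg _ _ hq.le, ← ENNReal.rpow_mul, one_div_mul_cancel hq.ne',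
          ENNReal.rpow_one, mul_assoc, mul_right_comm,
          ENNReal.inv_mul_cancel hv ENNReal.ofReal_ne_top, one_mul]
    _ ≤ _ := by gcongr

/-- **Lemma 3.5.**  If `(U,V)` satisfies the bump condition `[U,V]_{p,q,Φ} < ∞`, then the
`L^q` averages of `N_Q` over `Q` are uniformly bounded over the dyadic grid. -/
theorem NQ_Lq_bound {d n : ℕ} (α p q : ℝ)
    (hα0 : 0 ≤ α) (hαd : α < d) (hp : 1 < p) (hpq : p ≤ q)
    (hexp : 1 / p - 1 / q ≤ α / (d : ℝ))
    (Φ : ℝ → ℝ) (hΦ : IsYoungFunction Φ)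
    (𝒟 : Set (Cube d)) (h𝒟 : IsDyadicGrid 𝒟)
    (U V : Rd d → Mat n) (hU : IsMatrixWeight U) (hV : IsMatrixWeight V)
    (c₁ c₂ : ℝ) (hc₁ : 0 < c₁) (hc₂ : 0 < c₂)
    (𝒱 : Cube d → Mat n)
    (h𝒱 : ∀ R ∈ 𝒟, ReducesOrlicz c₁ c₂ Φ (fun x => matPow (V x) (-(1 / p))) R (𝒱 R))
    (hbump : bumpMax α p q Φ U V < ⊤) :
    (⨆ Q ∈ 𝒟, (ENNReal.ofReal Q.vol)⁻¹ * ∫⁻ x in Q.set, NQfun α p q 𝒟 U 𝒱 Q x ^ q) < ⊤ := by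
  have hd : 0 < d := by
    have : (0 : ℝ) < d := hα0.trans_lt hαd
    exact_mod_cast this
  have hq : 0 < q := by linarith
  set s : ℝ := α / (d : ℝ) + 1 / q - 1 / p
  have hs0 : 0 ≤ s := by linarith
  set L : ℝ := 2 * (n + 1) * (2 / c₁)
  have hL0 : 0 < L := by positivity
  set W : Rd d → Mat n := fun x => matPow (V x) (-(1 / p))
  have hW : ∀ᵐ y, (W y).IsHermitian := hV.2.mono fun y hy => matPow_isHermitian hy.1 _
  set F : Cube d → Rd d → ℝ≥0∞ := fun R x =>
    ENNReal.ofReal (R.vol ^ s * opNorm (matPow (U x) (1 / q) * 𝒱 R)) with hF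
  set C : ℝ := n * (c₂ * L)
  set C₁ : ℝ≥0∞ := (ENNReal.ofReal C * ENNReal.ofReal (n * c₂)) ^ q * bumpMax α p q Φ U V ^ q
    with hC₁
  have hFm : ∀ R ∈ 𝒟, AEMeasurable (F R) := fun R _ =>
    ((aemeasurable_opNorm_matPow_mul hU (by positivity) (𝒱 R)).const_mul _).ennreal_ofReal
  have hgood : ∀ Q ∈ 𝒟, ∀ R ∈ 𝒟, R.set ⊆ Q.set →
      ¬ (∃ i, ENNReal.ofReal L < luxNorm Φ R (colNorm W (𝒱 Q) i)) →
      ∀ x, F R x ≤ ENNReal.ofReal C * F Q x := by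
    intro Q hQ R hR hRQ hb x
    push Not at hb
    have h₁ : opNorm ((𝒱 Q)⁻¹ * 𝒱 R) ≤ C := by
      rw [opNorm_mul_comm_of_isHermitian (h𝒱 Q hQ).1.1.inv (h𝒱 R hR).1.1]
      exact (h𝒱 R hR).opNorm_mul_inv_le hc₂ hL0.le hb
    have hu : IsUnit (𝒱 Q).det := (Matrix.isUnit_iff_isUnit_det _).1 (h𝒱 Q hQ).1.isUnit
    have h₂ : matPow (U x) (1 / q) * 𝒱 R = matPow (U x) (1 / q) * 𝒱 Q * ((𝒱 Q)⁻¹ * 𝒱 R) := by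
      rw [mul_assoc, Matrix.mul_nonsing_inv_cancel_left _ _ hu]
    rw [hF, ← ENNReal.ofReal_mul (by positivity)]
    refine ENNReal.ofReal_le_ofReal ?_
    calc R.vol ^ s * opNorm (matPow (U x) (1 / q) * 𝒱 R)
        ≤ Q.vol ^ s * (opNorm (matPow (U x) (1 / q) * 𝒱 Q) * C) := by
          refine mul_le_mul
            (Real.rpow_le_rpow R.vol_pos.le (Cube.vol_le_of_subset hd hRQ) hs0) ?_
            (opNorm_nonneg _) (Real.rpow_nonneg Q.vol_pos.le _)
          rw [h₂]
          exact (opNorm_mul_le _ _).trans (mul_le_mul_of_nonneg_left h₁ (opNorm_nonneg _))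
      _ = _ := by ring
  have hself : ∀ Q ∈ 𝒟, ¬ ∃ i, ENNReal.ofReal L < luxNorm Φ Q (colNorm W (𝒱 Q) i) := by
    rintro Q hQ ⟨i, hi⟩
    refine (hi.trans ((h𝒱 Q hQ).luxNorm_colNorm_lt hc₁ i)).not_ge (ENNReal.ofReal_le_ofReal ?_)
    have : (0 : ℝ) ≤ n := by positivity
    exact le_mul_of_one_le_left (by positivity) (by linarith)
  have hint : ∀ Q ∈ 𝒟, ∫⁻ x in Q.set, (ENNReal.ofReal C * F Q x) ^ q ≤
      C₁ * ENNReal.ofReal Q.vol := by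
    intro Q hQ
    set lux : Rd d → ℝ≥0∞ := fun x =>
      luxNorm Φ Q fun y => opNorm (matPow (U x) (1 / q) * matPow (V y) (-(1 / p)))
    have hK : (ENNReal.ofReal C * ENNReal.ofReal (n * c₂)) ^ q *
        ENNReal.ofReal (Q.vol ^ s) ^ q ≠ ⊤ :=
      ENNReal.mul_ne_top
        (ENNReal.rpow_ne_top_of_nonneg hq.le
          (ENNReal.mul_ne_top ENNReal.ofReal_ne_top ENNReal.ofReal_ne_top))
        (ENNReal.rpow_ne_top_of_nonneg hq.le ENNReal.ofReal_ne_top)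
    calc ∫⁻ x in Q.set, (ENNReal.ofReal C * F Q x) ^ q
        ≤ ∫⁻ x in Q.set, (ENNReal.ofReal C * ENNReal.ofReal (n * c₂)) ^ q *
            ENNReal.ofReal (Q.vol ^ s) ^ q * lux x ^ q := by
          refine lintegral_mono_ae (ae_restrict_of_ae (hU.2.mono fun x hx => ?_))
          rw [← ENNReal.mul_rpow_of_nonneg _ _ hq.le, ← ENNReal.mul_rpow_of_nonneg _ _ hq.le]
          refine ENNReal.rpow_le_rpow ?_ hq.le
          have h₁ := (h𝒱 Q hQ).ofReal_opNorm_mul_le hΦ (matPow_isHermitian hx.1 (1 / q)) hW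
          calc ENNReal.ofReal C * F Q x
              ≤ ENNReal.ofReal C *
                  (ENNReal.ofReal (Q.vol ^ s) * (ENNReal.ofReal (n * c₂) * lux x)) := by
                simp only [hF]
                rw [ENNReal.ofReal_mul (Real.rpow_nonneg Q.vol_pos.le _)]
                gcongr
            _ = _ := by ring
      _ = (ENNReal.ofReal C * ENNReal.ofReal (n * c₂)) ^ q *
            (ENNReal.ofReal (Q.vol ^ s) ^ q * ∫⁻ x in Q.set, lux x ^ q) := by
          rw [lintegral_const_mul' _ _ hK, mul_assoc]
      _ ≤ C₁ * ENNReal.ofReal Q.vol := by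
          rw [hC₁, mul_assoc]
          refine mul_le_mul_right ?_ _
          exact lintegral_luxNorm_rpow_le_bumpMax hq Q
  have hC₁top : C₁ < ⊤ := by
    rw [hC₁]
    exact ENNReal.mul_lt_top
      (ENNReal.rpow_lt_top_of_nonneg hq.le
        (ENNReal.mul_ne_top ENNReal.ofReal_ne_top ENNReal.ofReal_ne_top))
      (ENNReal.rpow_lt_top_of_nonneg hq.le hbump.ne)
  refine (iSup₂_le fun Q hQ => ?_).trans_lt (ENNReal.mul_lt_top ENNReal.ofNat_lt_top hC₁top :
    2 * C₁ < ⊤)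
  have key : ∫⁻ x in Q.set, NQfun α p q 𝒟 U 𝒱 Q x ^ q ≤ 2 * C₁ * ENNReal.ofReal Q.vol :=
    lintegral_iSup_le_of_stopping h𝒟 hd hFm hq hgood hself
      (fun Q hQ S hS hdisj => (h𝒱 Q hQ).tsum_vol_le hc₁ hΦ
        (h𝒟.countable.mono fun R hR => (hS hR).1) (fun R hR => (hS hR).2.1) hdisj
        fun R hR => (hS hR).2.2) hint hQ
  rw [mul_comm, ← div_eq_mul_inv]
  exact ENNReal.div_le_of_le_mul key

end
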